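/- Let d ≥ 2 be an integer, k > 0, and set l_k := π/(2√k). Let ν_d and ν_{d−1} be Borel probability measures on (0, l_k], let c := ∫_{(0,l_k]} ∫_{−R}^{R} cos^{d−1}(√k·h) dh dν_d(R), and assume that for every r ∈ [0, l_k): c·ν_{d−1}((r,l_k]) = ∫_{(r,l_k]} ∫_{−α_k(R,r)}^{α_k(R,r)} cos^{d−1}(√k·h) dh dν_d(R). Then for every a ∈ (0, l_k): ∫_{(a,l_k]} cos^{d−1}(√k·y) · (cos²(√k·a) − cos²(√k·y))^{−1/2} dν_{d−1}(y) = (π/(c·√k)) · (cos(√k·a))^{−1} · ∫_{(a,l_k]} cos^{d−1}(√k·z) dν_d(z). -/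

import Mathlib

open MeasureTheory Real

/-- Section radius in spherical space of curvature `k > 0`. -/
noncomputable def alphaPos (k t h : ℝ) : ℝ :=
  (1 / Real.sqrt k) * Real.arccos (Real.cos (Real.sqrt k * t) / Real.cos (Real.sqrt k * h))

lemma cos_sqrt_mul_pos {k lk : ℝ} (hlk : √k * lk = π / 2) {h R : ℝ} (hk : 0 < k)
    (hR : R ≤ lk) (hh : |h| < R) : 0 < cos (√k * h) := by
  have hs : 0 < √k := Real.sqrt_pos.2 hk
  have h1 : √k * |h| < π / 2 := hlk ▸ mul_lt_mul_of_pos_left (hh.trans_le hR) hs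
  rw [← cos_abs, abs_mul, abs_of_pos hs]
  exact cos_pos_of_mem_Ioo ⟨by linarith [pi_pos, mul_nonneg hs.le (abs_nonneg h)], h1⟩

lemma cos_sqrt_mul_nonneg {k lk : ℝ} (hlk : √k * lk = π / 2) {R : ℝ} (hk : 0 < k)
    (hR0 : 0 ≤ R) (hR : R ≤ lk) : 0 ≤ cos (√k * R) := by
  have hs : 0 < √k := Real.sqrt_pos.2 hk
  have h1 : √k * R ≤ π / 2 := hlk ▸ mul_le_mul_of_nonneg_left hR hs.le
  exact cos_nonneg_of_mem_Icc ⟨by linarith [pi_pos, mul_nonneg hs.le hR0], h1⟩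

lemma lt_alphaPos_iff {k lk : ℝ} (hk : 0 < k) (hlk : √k * lk = π / 2) {r t h : ℝ}
    (hr0 : 0 ≤ r) (hr : r ≤ lk) (ht : 0 ≤ cos (√k * t)) (hh : 0 < cos (√k * h)) :
    r < alphaPos k t h ↔ cos (√k * t) < cos (√k * r) * cos (√k * h) := by
  have hs : 0 < √k := Real.sqrt_pos.2 hk
  have h0 : 0 ≤ √k * r := mul_nonneg hs.le hr0
  have h1 : √k * r ≤ π := by
    linarith [mul_le_mul_of_nonneg_left hr hs.le, pi_pos]
  have hq : 0 ≤ cos (√k * t) / cos (√k * h) := div_nonneg ht hh.le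
  rw [alphaPos, one_div, lt_inv_mul_iff₀ hs, ← div_lt_iff₀ hh]
  constructor
  · intro H
    by_contra! hc
    have := arccos_le_arccos hc
    rw [arccos_cos h0 h1] at this
    linarith
  · intro H
    have := arccos_lt_arccos (by linarith) H (cos_le_one _)
    rwa [arccos_cos h0 h1] at this

lemma cos_sqrt_mul_alphaPos {k lk : ℝ} (hk : 0 < k) (hlk : √k * lk = π / 2) {r t h : ℝ}
    (hr0 : 0 ≤ r) (hr : r ≤ lk) (ht : 0 ≤ cos (√k * t)) (hh : 0 < cos (√k * h))
    (H : r < alphaPos k t h) :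
    cos (√k * alphaPos k t h) = cos (√k * t) / cos (√k * h) := by
  have hs : 0 < √k := Real.sqrt_pos.2 hk
  have H' := (lt_alphaPos_iff hk hlk hr0 hr ht hh).1 H
  have : √k * alphaPos k t h = arccos (cos (√k * t) / cos (√k * h)) := by
    rw [alphaPos]; field_simp
  rw [this, cos_arccos]
  · linarith [div_nonneg ht hh.le]
  · rw [div_le_one hh]
    nlinarith [cos_le_one (√k * r)]

lemma cos_sqrt_mul_lt_iff {k lk : ℝ} (hk : 0 < k) (hlk : √k * lk = π / 2) {x y : ℝ}
    (hx0 : 0 ≤ x) (hx : x ≤ lk) (hy0 : 0 ≤ y) (hy : y ≤ lk) :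
    cos (√k * x) < cos (√k * y) ↔ y < x := by
  have hs : 0 < √k := Real.sqrt_pos.2 hk
  have hb : ∀ z, 0 ≤ z → z ≤ lk → √k * z ∈ Set.Icc 0 π := fun z h0 h1 =>
    ⟨mul_nonneg hs.le h0, by linarith [mul_le_mul_of_nonneg_left h1 hs.le, pi_pos]⟩
  rw [strictAntiOn_cos.lt_iff_gt (hb x hx0 hx) (hb y hy0 hy), mul_lt_mul_iff_right₀ hs]

lemma alphaPos_nonneg (k t h : ℝ) : 0 ≤ alphaPos k t h :=
  mul_nonneg (by positivity) (arccos_nonneg _)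

lemma alphaPos_le {k lk : ℝ} (hk : 0 < k) (hlk : √k * lk = π / 2) {t h : ℝ}
    (ht : 0 ≤ cos (√k * t)) (hh : 0 < cos (√k * h)) : alphaPos k t h ≤ lk := by
  have hs : 0 < √k := Real.sqrt_pos.2 hk
  rw [alphaPos, one_div, inv_mul_le_iff₀ hs, hlk]
  exact arccos_le_pi_div_two.2 (div_nonneg ht hh.le)

/-- Duality between the height `h` and the section radius. -/
lemma abs_lt_and_lt_alphaPos_iff {k lk : ℝ} (hk : 0 < k) (hlk : √k * lk = π / 2) {r R h : ℝ}
    (hr0 : 0 ≤ r) (hR0 : 0 < R) (hR : R ≤ lk) :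
    (|h| < R ∧ r < alphaPos k R h) ↔ (r < R ∧ |h| < alphaPos k R r) := by
  have hcR := cos_sqrt_mul_nonneg hlk hk hR0.le hR
  have key : ∀ x, 0 ≤ x → x ≤ lk → 0 ≤ cos (√k * x) := fun x => cos_sqrt_mul_nonneg hlk hk
  have habs : cos (√k * |h|) = cos (√k * h) := by
    rw [← cos_abs (√k * h), abs_mul, abs_of_nonneg (Real.sqrt_nonneg k)]
  constructor
  · rintro ⟨h1, h2⟩
    have hch := cos_sqrt_mul_pos hlk hk hR h1
    have hrl : r ≤ lk := h2.le.trans (alphaPos_le hk hlk hcR hch)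
    have h3 := (lt_alphaPos_iff hk hlk hr0 hrl hcR hch).1 h2
    have h4 : cos (√k * R) < cos (√k * r) :=
      h3.trans_le (mul_le_of_le_one_right (key r hr0 hrl) (cos_le_one _))
    refine ⟨(cos_sqrt_mul_lt_iff hk hlk hR0.le hR hr0 hrl).1 h4, ?_⟩
    rw [lt_alphaPos_iff hk hlk (abs_nonneg h) (h1.le.trans hR) hcR (hcR.trans_lt h4), habs,
      mul_comm (cos _)]
    exact h3
  · rintro ⟨h1, h2⟩
    have hcr : 0 < cos (√k * r) :=
      hcR.trans_lt ((cos_sqrt_mul_lt_iff hk hlk hR0.le hR hr0 (h1.le.trans hR)).2 h1)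
    have hhl : |h| ≤ lk := h2.le.trans (alphaPos_le hk hlk hcR hcr)
    have h3 := (lt_alphaPos_iff hk hlk (abs_nonneg h) hhl hcR hcr).1 h2
    have h4 : cos (√k * R) < cos (√k * |h|) :=
      h3.trans_le (mul_le_of_le_one_right (key _ (abs_nonneg h) hhl) (cos_le_one _))
    refine ⟨(cos_sqrt_mul_lt_iff hk hlk hR0.le hR (abs_nonneg h) hhl).1 h4, ?_⟩
    rw [lt_alphaPos_iff hk hlk hr0 (h1.le.trans hR) hcR (habs ▸ hcR.trans_lt h4), ← habs,
      mul_comm (cos _)]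
    exact h3

lemma measurable_alphaPos (k : ℝ) : Measurable fun p : ℝ × ℝ => alphaPos k p.1 p.2 := by
  unfold alphaPos
  have := continuous_arccos.measurable
  fun_prop

/-- The measure counting the section radii `alphaPos k R h`, for `R` distributed as `ν` and
`h ∈ (-R, R)` with density `cos (√k h) ^ n`. -/
noncomputable def sectionMeasure (k : ℝ) (n : ℕ) (ν : Measure ℝ) : Measure ℝ :=
  ((ν.prod volume).withDensity (({p : ℝ × ℝ | |p.2| < p.1}).indicator
    fun p => ENNReal.ofReal (cos (√k * p.2) ^ n))).map fun p => alphaPos k p.1 p.2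

open scoped ENNReal in
lemma lintegral_sectionMeasure (k : ℝ) (n : ℕ) (ν : Measure ℝ) [IsFiniteMeasure ν]
    {F : ℝ → ℝ≥0∞} (hF : Measurable F) :
    ∫⁻ y, F y ∂(sectionMeasure k n ν) = ∫⁻ R, (∫⁻ h in {h : ℝ | |h| < R},
      ENNReal.ofReal (cos (√k * h) ^ n) * F (alphaPos k R h)) ∂ν := by
  have hα := measurable_alphaPos k
  have hset : MeasurableSet {p : ℝ × ℝ | |p.2| < p.1} :=
    measurableSet_lt (by fun_prop) (by fun_prop)
  have hw : Measurable (({p : ℝ × ℝ | |p.2| < p.1}).indicator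
    fun p => ENNReal.ofReal (cos (√k * p.2) ^ n)) := Measurable.indicator (by fun_prop) hset
  have hFα : Measurable fun p : ℝ × ℝ => F (alphaPos k p.1 p.2) := hF.comp hα
  rw [sectionMeasure, lintegral_map hF hα, lintegral_withDensity_eq_lintegral_mul _ hw hFα,
    lintegral_prod _ (hw.mul hFα).aemeasurable]
  refine lintegral_congr fun R => ?_
  rw [← lintegral_indicator (measurableSet_lt (by fun_prop) (by fun_prop))]
  refine lintegral_congr fun h => ?_
  by_cases hh : |h| < R <;> simp [hh]

open scoped ENNReal in
lemma setLIntegral_sectionMeasure_Ioi {k lk : ℝ} (hk : 0 < k) (hlk : √k * lk = π / 2) (n : ℕ)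
    (ν : Measure ℝ) [IsFiniteMeasure ν] {r : ℝ} (hr : 0 ≤ r) {F : ℝ → ℝ≥0∞} (hF : Measurable F) :
    ∫⁻ y in Set.Ioi r, F y ∂(sectionMeasure k n (ν.restrict (Set.Ioc 0 lk))) =
      ∫⁻ R in Set.Ioc r lk, (∫⁻ h in Set.Ioo (-(alphaPos k R r)) (alphaPos k R r),
        ENNReal.ofReal (cos (√k * h) ^ n) * F (alphaPos k R h)) ∂ν := by
  have hsub : Set.Ioc r lk = Set.Ioi r ∩ Set.Ioc 0 lk := by
    ext x; simp only [Set.mem_Ioc, Set.mem_inter_iff, Set.mem_Ioi]; constructor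
    · rintro ⟨h1, h2⟩; exact ⟨h1, hr.trans_lt h1, h2⟩
    · rintro ⟨h1, _, h2⟩; exact ⟨h1, h2⟩
  rw [← lintegral_indicator measurableSet_Ioi, lintegral_sectionMeasure _ _ _
    (hF.indicator measurableSet_Ioi), hsub, ← Measure.restrict_restrict measurableSet_Ioi,
    ← lintegral_indicator measurableSet_Ioi]
  refine setLIntegral_congr_fun measurableSet_Ioc fun R hR => ?_
  have habs : MeasurableSet {h : ℝ | |h| < R} := measurableSet_lt (by fun_prop) (by fun_prop)
  rw [← lintegral_indicator habs]
  have hiff := fun h => abs_lt_and_lt_alphaPos_iff (h := h) hk hlk hr hR.1 hR.2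
  by_cases hrR : r < R
  · rw [Set.indicator_of_mem (Set.mem_Ioi.2 hrR), ← lintegral_indicator measurableSet_Ioo]
    refine lintegral_congr fun h => ?_
    have := hiff h
    rw [abs_lt (b := alphaPos k R r)] at this
    simp only [Set.indicator_apply, Set.mem_ofPred_eq, Set.mem_Ioi, Set.mem_Ioo, mul_ite, mul_zero]
    grind
  · rw [Set.indicator_of_notMem (by simpa using hrR), ← lintegral_zero (μ := (volume : Measure ℝ))]
    refine lintegral_congr fun h => ?_
    have := hiff h
    simp only [Set.indicator_apply, Set.mem_ofPred_eq, Set.mem_Ioi, mul_ite, mul_zero]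
    grind

lemma cos_sqrt_mul_pos_of_abs_lt_alphaPos {k lk : ℝ} (hk : 0 < k) (hlk : √k * lk = π / 2)
    {r R h : ℝ} (hr0 : 0 ≤ r) (hrR : r < R) (hR : R ≤ lk) (hh : |h| < alphaPos k R r) :
    0 < cos (√k * h) :=
  cos_sqrt_mul_pos hlk hk hR
    ((abs_lt_and_lt_alphaPos_iff hk hlk hr0 (hr0.trans_lt hrR) hR).2 ⟨hrR, hh⟩).1

lemma continuous_integral_cos_pow (k : ℝ) (n : ℕ) :
    Continuous fun x : ℝ => ∫ h in (-x)..x, cos (√k * h) ^ n := by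
  have hc : Continuous fun h : ℝ => cos (√k * h) ^ n := by fun_prop
  have hi : ∀ a b : ℝ, IntervalIntegrable (fun h : ℝ => cos (√k * h) ^ n) volume a b :=
    fun a b => hc.intervalIntegrable a b
  have : (fun x : ℝ => ∫ h in (-x)..x, cos (√k * h) ^ n) = fun x : ℝ =>
      (∫ h in (0 : ℝ)..x, cos (√k * h) ^ n) - ∫ h in (0 : ℝ)..(-x), cos (√k * h) ^ n := by
    funext x
    rw [intervalIntegral.integral_interval_sub_left (hi _ _) (hi _ _)]
  rw [this]
  have hp := intervalIntegral.continuous_primitive hi 0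
  exact hp.sub (hp.comp continuous_neg)

lemma continuous_alphaPos_left (k r : ℝ) : Continuous fun R => alphaPos k R r := by
  unfold alphaPos
  have := continuous_arccos
  fun_prop

lemma sectionMeasure_Ioi {k lk : ℝ} (hk : 0 < k) (hlk : √k * lk = π / 2) (n : ℕ)
    (ν : Measure ℝ) [IsFiniteMeasure ν] {r : ℝ} (hr : 0 ≤ r) :
    sectionMeasure k n (ν.restrict (Set.Ioc 0 lk)) (Set.Ioi r) =
      ENNReal.ofReal (∫ R in Set.Ioc r lk,
        (∫ h in (-(alphaPos k R r))..(alphaPos k R r), cos (√k * h) ^ n) ∂ν) := by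
  have hA : Continuous fun R => ∫ h in (-(alphaPos k R r))..(alphaPos k R r), cos (√k * h) ^ n :=
    (continuous_integral_cos_pow k n).comp (continuous_alphaPos_left k r)
  have hnn : ∀ R ∈ Set.Ioc r lk, ∀ h ∈ Set.Ioo (-(alphaPos k R r)) (alphaPos k R r),
      0 ≤ cos (√k * h) ^ n := fun R hR h hh =>
    pow_nonneg (cos_sqrt_mul_pos_of_abs_lt_alphaPos hk hlk hr hR.1 hR.2 (abs_lt.2 hh)).le n
  have hle : ∀ R, -(alphaPos k R r) ≤ alphaPos k R r := fun R => by
    linarith [alphaPos_nonneg k R r]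
  have hint : ∀ R, ∫ h in (-(alphaPos k R r))..(alphaPos k R r), cos (√k * h) ^ n =
      ∫ h in Set.Ioo (-(alphaPos k R r)) (alphaPos k R r), cos (√k * h) ^ n := fun R => by
    rw [intervalIntegral.integral_of_le (hle R), integral_Ioc_eq_integral_Ioo]
  rw [← setLIntegral_one, setLIntegral_sectionMeasure_Ioi hk hlk n ν hr measurable_const,
    ofReal_integral_eq_lintegral_ofReal hA.integrableOn_Ioc]
  · refine setLIntegral_congr_fun measurableSet_Ioc fun R hR => ?_
    simp only [mul_one]
    rw [hint, ofReal_integral_eq_lintegral_ofReal]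
    · exact (Continuous.integrableOn_Icc (by fun_prop)).mono_set Set.Ioo_subset_Icc_self
    · exact ae_restrict_of_forall_mem measurableSet_Ioo (hnn R hR)
  · refine ae_restrict_of_forall_mem measurableSet_Ioc fun R hR => ?_
    simp only [hint]
    exact setIntegral_nonneg measurableSet_Ioo (hnn R hR)

lemma ext_restrict_Ioi_of_Ioi {μ ν : Measure ℝ} (a : ℝ) (hfin : μ (Set.Ioi a) ≠ ⊤)
    (h : ∀ r, a ≤ r → μ (Set.Ioi r) = ν (Set.Ioi r)) :
    μ.restrict (Set.Ioi a) = ν.restrict (Set.Ioi a) := by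
  have : IsFiniteMeasure (μ.restrict (Set.Ioi a)) := ⟨by simpa using hfin.lt_top⟩
  refine ext_of_generate_finite (Set.range Set.Ioi) (borel_eq_generateFrom_Ioi ℝ ▸
    BorelSpace.measurable_eq) isPiSystem_Ioi ?_ (by simpa using h a le_rfl)
  rintro _ ⟨r, rfl⟩
  rw [Measure.restrict_apply measurableSet_Ioi, Measure.restrict_apply measurableSet_Ioi,
    Set.Ioi_inter_Ioi]
  exact h _ le_sup_right

/-- The Abel kernel integral over a single section. -/
lemma setLIntegral_abel_kernel {k lk : ℝ} (hk : 0 < k) (hlk : √k * lk = π / 2) {a R : ℝ}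
    (ha : 0 ≤ a) (haR : a < R) (hR : R ≤ lk) :
    ∫⁻ h in Set.Ioo (-(alphaPos k R a)) (alphaPos k R a), ENNReal.ofReal
        (cos (√k * h) * (√(cos (√k * a) ^ 2 * cos (√k * h) ^ 2 - cos (√k * R) ^ 2))⁻¹) =
      ENNReal.ofReal (π / (√k * cos (√k * a))) := by
  have hs : 0 < √k := Real.sqrt_pos.2 hk
  have hcR := cos_sqrt_mul_nonneg hlk hk (ha.trans haR.le) hR
  have hcc := (cos_sqrt_mul_lt_iff hk hlk (ha.trans haR.le) hR ha (haR.le.trans hR)).2 haR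
  set β := alphaPos k R a with hβ
  set A := cos (√k * a) with hA
  set B := cos (√k * R) with hB
  have hA0 : 0 < A := hcR.trans_lt hcc
  have hβ0 : 0 ≤ β := alphaPos_nonneg k R a
  have hD2 : 0 < A ^ 2 - B ^ 2 := by nlinarith
  set D := √(A ^ 2 - B ^ 2) with hD
  have hD0 : 0 < D := Real.sqrt_pos.2 hD2
  have hDsq : D ^ 2 = A ^ 2 - B ^ 2 := Real.sq_sqrt hD2.le
  have hlt : ∀ h ∈ Set.Ioo (-β) β, 0 < cos (√k * h) ∧ B < A * cos (√k * h) := fun h hh => by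
    have h2 := (abs_lt_and_lt_alphaPos_iff hk hlk ha (ha.trans_lt haR) hR).2
      ⟨haR, abs_lt.2 hh⟩
    have h3 := cos_sqrt_mul_pos hlk hk hR h2.1
    exact ⟨h3, (lt_alphaPos_iff hk hlk ha (haR.le.trans hR) hcR h3).1 h2.2⟩
  set g : ℝ → ℝ := fun h => arcsin (A / D * sin (√k * h)) / (√k * A) with hg
  have hgc : Continuous g := by
    have := continuous_arcsin
    fun_prop
  have hder : ∀ h ∈ Set.Ioo (-β) β, HasDerivAt g
      (cos (√k * h) * (√(A ^ 2 * cos (√k * h) ^ 2 - B ^ 2))⁻¹) h := fun h hh => by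
    obtain ⟨h1, h2⟩ := hlt h hh
    have hE : 0 < A ^ 2 * cos (√k * h) ^ 2 - B ^ 2 := by nlinarith
    have hEq : 1 - (A / D * sin (√k * h)) ^ 2 = (A ^ 2 * cos (√k * h) ^ 2 - B ^ 2) / D ^ 2 := by
      have : sin (√k * h) ^ 2 = 1 - cos (√k * h) ^ 2 := sin_sq _
      rw [mul_pow, this]; field_simp; rw [hDsq]; ring
    have hpos : 0 < 1 - (A / D * sin (√k * h)) ^ 2 := hEq ▸ div_pos hE (by positivity)
    have d1 : HasDerivAt (fun h => A / D * sin (√k * h)) (A / D * (cos (√k * h) * √k)) h := by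
      have := ((hasDerivAt_id h).const_mul (√k)).sin.const_mul (A / D)
      simpa using this
    have hm1 : A / D * sin (√k * h) ≠ -1 := fun h => by rw [h] at hpos; norm_num at hpos
    have h1' : A / D * sin (√k * h) ≠ 1 := fun h => by rw [h] at hpos; norm_num at hpos
    refine (((hasDerivAt_arcsin hm1 h1').comp h d1).div_const (√k * A)).congr_deriv ?_
    rw [hEq, Real.sqrt_div hE.le, Real.sqrt_sq hD0.le]
    have := (Real.sqrt_pos.2 hE).ne'
    field_simp
  have hnn : ∀ h ∈ Set.Ioo (-β) β,
      0 ≤ cos (√k * h) * (√(A ^ 2 * cos (√k * h) ^ 2 - B ^ 2))⁻¹ := fun h hh =>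
    mul_nonneg (hlt h hh).1.le (by positivity)
  have hii := intervalIntegral.integrableOn_deriv_of_nonneg hgc.continuousOn hder hnn
  have hle : -β ≤ β := by linarith
  have hFTC := intervalIntegral.integral_eq_sub_of_hasDerivAt_of_le hle hgc.continuousOn hder
    ((intervalIntegrable_iff_integrableOn_Ioc_of_le hle).2 hii)
  rw [← ofReal_integral_eq_lintegral_ofReal (hii.mono_set Set.Ioo_subset_Ioc_self)
    (ae_restrict_of_forall_mem measurableSet_Ioo hnn), ← integral_Ioc_eq_integral_Ioo,
    ← intervalIntegral.integral_of_le hle, hFTC]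
  have hsin : A / D * sin (√k * β) = 1 := by
    have : √k * β = arccos (B / A) := by rw [hβ, alphaPos, ← hA, ← hB]; field_simp
    rw [this, sin_arccos]
    have : 1 - (B / A) ^ 2 = (A ^ 2 - B ^ 2) / A ^ 2 := by field_simp
    rw [this, Real.sqrt_div hD2.le, Real.sqrt_sq hA0.le, ← hD]
    field_simp
  have hgβ : g β = π / 2 / (√k * A) := by simp only [hg, hsin, arcsin_one]
  have hgβ' : g (-β) = -(π / 2 / (√k * A)) := by
    simp only [hg, mul_neg, sin_neg, hsin, arcsin_neg, arcsin_one, neg_div]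
  rw [hgβ, hgβ']
  congr 1
  ring

lemma setLIntegral_abel_section {k lk : ℝ} (hk : 0 < k) (hlk : √k * lk = π / 2) (n : ℕ)
    {a R : ℝ} (ha : 0 ≤ a) (haR : a < R) (hR : R ≤ lk) :
    ∫⁻ h in Set.Ioo (-(alphaPos k R a)) (alphaPos k R a), ENNReal.ofReal (cos (√k * h) ^ n) *
        ENNReal.ofReal (cos (√k * alphaPos k R h) ^ n *
          (cos (√k * a) ^ 2 - cos (√k * alphaPos k R h) ^ 2) ^ (-(1 / 2) : ℝ)) =
      ENNReal.ofReal (π / (√k * cos (√k * a)) * cos (√k * R) ^ n) := by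
  have hcR := cos_sqrt_mul_nonneg hlk hk (ha.trans haR.le) hR
  have hcc := (cos_sqrt_mul_lt_iff hk hlk (ha.trans haR.le) hR ha (haR.le.trans hR)).2 haR
  rw [ENNReal.ofReal_mul' (pow_nonneg hcR n), ← setLIntegral_abel_kernel hk hlk ha haR hR,
    ← lintegral_mul_const' _ _ ENNReal.ofReal_ne_top]
  refine setLIntegral_congr_fun measurableSet_Ioo fun h hh => ?_
  have h2 := (abs_lt_and_lt_alphaPos_iff hk hlk ha (ha.trans_lt haR) hR).2 ⟨haR, abs_lt.2 hh⟩
  have h3 := cos_sqrt_mul_pos hlk hk hR h2.1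
  have h4 := (lt_alphaPos_iff hk hlk ha (haR.le.trans hR) hcR h3).1 h2.2
  have hE : 0 < cos (√k * a) ^ 2 * cos (√k * h) ^ 2 - cos (√k * R) ^ 2 := by nlinarith
  rw [← ENNReal.ofReal_mul (pow_nonneg h3.le n), ← ENNReal.ofReal_mul' (pow_nonneg hcR n),
    cos_sqrt_mul_alphaPos hk hlk ha (haR.le.trans hR) hcR h3 h2.2]
  have hq : cos (√k * a) ^ 2 - (cos (√k * R) / cos (√k * h)) ^ 2 =
      (cos (√k * a) ^ 2 * cos (√k * h) ^ 2 - cos (√k * R) ^ 2) / cos (√k * h) ^ 2 := by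
    field_simp
  have hq0 := div_pos hE (pow_pos h3 2)
  rw [hq, rpow_neg hq0.le, ← Real.sqrt_eq_rpow, Real.sqrt_div hE.le, Real.sqrt_sq h3.le, div_pow]
  congr 1
  field_simp

/-- Abel-type consequence of the section formula in positive curvature. -/
theorem wicksell_abel_identity_pos
    (d : ℕ) (hd : 2 ≤ d) (k : ℝ) (hk : 0 < k)
    (lk : ℝ) (hlk : lk = Real.pi / (2 * Real.sqrt k))
    (νd νd1 : Measure ℝ) [IsProbabilityMeasure νd] [IsProbabilityMeasure νd1]
    (hνd : νd (Set.Ioc 0 lk)ᶜ = 0) (hνd1 : νd1 (Set.Ioc 0 lk)ᶜ = 0)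
    (c : ℝ)
    (hc : c = ∫ R in Set.Ioc (0 : ℝ) lk,
        (∫ h in (-R)..R, Real.cos (Real.sqrt k * h) ^ (d - 1)) ∂νd)
    (hsec : ∀ r : ℝ, 0 ≤ r → r < lk →
      c * (νd1 (Set.Ioc r lk)).toReal
        = ∫ R in Set.Ioc r lk,
            (∫ h in (-(alphaPos k R r))..(alphaPos k R r),
              Real.cos (Real.sqrt k * h) ^ (d - 1)) ∂νd) :
    ∀ a : ℝ, 0 < a → a < lk →
      ∫ y in Set.Ioc a lk,
          Real.cos (Real.sqrt k * y) ^ (d - 1) *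
            (Real.cos (Real.sqrt k * a) ^ 2 - Real.cos (Real.sqrt k * y) ^ 2)
              ^ (-(1 / 2) : ℝ) ∂νd1
        = (Real.pi / (c * Real.sqrt k)) * (Real.cos (Real.sqrt k * a))⁻¹ *
            ∫ z in Set.Ioc a lk, Real.cos (Real.sqrt k * z) ^ (d - 1) ∂νd := by
  intro a ha hal
  have hs : 0 < √k := Real.sqrt_pos.2 hk
  replace hlk : √k * lk = π / 2 := by rw [hlk]; field_simp
  set n := d - 1
  have hcpos : 0 < c := by
    have hpos : ∀ R ∈ Set.Ioc 0 lk, 0 < ∫ h in (-R)..R, cos (√k * h) ^ n := fun R hR => by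
      refine intervalIntegral.intervalIntegral_pos_of_pos_on
        (Continuous.intervalIntegrable (by fun_prop) _ _) (fun h hh => ?_) (by linarith [hR.1])
      exact pow_pos (cos_sqrt_mul_pos hlk hk hR.2 (abs_lt.2 hh)) n
    rw [hc, setIntegral_pos_iff_support_of_nonneg_ae
      (ae_restrict_of_forall_mem measurableSet_Ioc fun R hR => (hpos R hR).le)
      (continuous_integral_cos_pow k n).integrableOn_Ioc, Set.inter_eq_right.2
      (fun R hR => Function.mem_support.2 (hpos R hR).ne'),
      (prob_compl_eq_zero_iff measurableSet_Ioc).1 hνd]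
    exact one_pos
  have hIoi : ∀ r, νd1.restrict (Set.Ioi r) = νd1.restrict (Set.Ioc r lk) := fun r => by
    refine Measure.restrict_congr_set ?_
    filter_upwards [measure_eq_zero_iff_ae_notMem.1 hνd1] with x hx
    simp only [Set.mem_compl_iff, not_not] at hx
    exact propext ⟨fun h => ⟨h, hx.2⟩, fun h => h.1⟩
  have hM : (ENNReal.ofReal c • νd1).restrict (Set.Ioi 0) =
      (sectionMeasure k n (νd.restrict (Set.Ioc 0 lk))).restrict (Set.Ioi 0) := by
    refine ext_restrict_Ioi_of_Ioi 0
      (ENNReal.mul_ne_top ENNReal.ofReal_ne_top (measure_ne_top _ _)) fun r hr => ?_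
    have h1 : νd1 (Set.Ioi r) = νd1 (Set.Ioc r lk) := by
      simpa using congrArg (fun μ : Measure ℝ => μ Set.univ) (hIoi r)
    rw [sectionMeasure_Ioi hk hlk n νd hr, Measure.smul_apply, smul_eq_mul, h1]
    rcases lt_or_ge r lk with hrl | hrl
    · rw [← hsec r hr hrl, ENNReal.ofReal_mul hcpos.le, ENNReal.ofReal_toReal (measure_ne_top _ _)]
    · simp [Set.Ioc_eq_empty hrl.not_gt]
  set f : ℝ → ℝ := fun y => cos (√k * y) ^ n *
    (cos (√k * a) ^ 2 - cos (√k * y) ^ 2) ^ (-(1 / 2) : ℝ) with hf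
  have hfm : Measurable f := by fun_prop
  have hca : 0 < cos (√k * a) := cos_sqrt_mul_pos hlk hk le_rfl (by rwa [abs_of_pos ha])
  have hcos : ∀ y ∈ Set.Ioc a lk, 0 ≤ cos (√k * y) := fun y hy =>
    cos_sqrt_mul_nonneg hlk hk (ha.le.trans hy.1.le) hy.2
  have hfn : ∀ y ∈ Set.Ioc a lk, 0 ≤ f y := fun y hy => by
    have h1 := hcos y hy
    have h2 := (cos_sqrt_mul_lt_iff hk hlk (ha.le.trans hy.1.le) hy.2 ha.le hal.le).2 hy.1
    exact mul_nonneg (pow_nonneg h1 n) (rpow_nonneg (by nlinarith) _)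
  have hL : ENNReal.ofReal c * ∫⁻ y in Set.Ioc a lk, ENNReal.ofReal (f y) ∂νd1 =
      ENNReal.ofReal (π / (√k * cos (√k * a)) * ∫ z in Set.Ioc a lk, cos (√k * z) ^ n ∂νd) := by
    have h1 : (Set.Ioi a ∩ Set.Ioi 0 : Set ℝ) = Set.Ioi a := by
      rw [Set.Ioi_inter_Ioi, sup_eq_left.2 ha.le]
    rw [← hIoi a, ← smul_eq_mul, ← lintegral_smul_measure, ← Measure.restrict_smul, ← h1,
      ← Measure.restrict_restrict measurableSet_Ioi, hM,
      Measure.restrict_restrict measurableSet_Ioi, h1,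
      setLIntegral_sectionMeasure_Ioi hk hlk n νd ha.le hfm.ennreal_ofReal,
      ← integral_const_mul, ofReal_integral_eq_lintegral_ofReal
        (Continuous.integrableOn_Ioc (by fun_prop))]
    · exact setLIntegral_congr_fun measurableSet_Ioc fun R hR =>
        setLIntegral_abel_section hk hlk n ha.le hR.1 hR.2
    · exact ae_restrict_of_forall_mem measurableSet_Ioc fun R hR =>
        mul_nonneg (by positivity) (pow_nonneg (hcos R hR) n)
  have hR0 : 0 ≤ ∫ z in Set.Ioc a lk, cos (√k * z) ^ n ∂νd :=
    setIntegral_nonneg measurableSet_Ioc fun R hR => pow_nonneg (hcos R hR) n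
  have hL' := congrArg ENNReal.toReal hL
  rw [ENNReal.toReal_mul, ENNReal.toReal_ofReal hcpos.le, ENNReal.toReal_ofReal (by positivity),
    ← integral_eq_lintegral_of_nonneg_ae (ae_restrict_of_forall_mem measurableSet_Ioc hfn)
      hfm.aestronglyMeasurable] at hL'
  rw [eq_div_of_mul_eq hcpos.ne' ((mul_comm _ _).trans hL')]
  field_simp
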